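/- arXiv:1112.0759 — 8 statements merged into one kernel-verified Lean document; each statement's English description precedes it below -/
import Mathlib

section
/- Let A be a commutative ℝ-algebra and {·,·} a Jacobi bracket on A. Then there exists a unique Poisson bracket {·,·}' on the Laurent polynomial algebra A[t,t⁻¹] that is homogeneous of degree −1 with respect to the ℤ-grading with deg t = 1 and that satisfies {t·F, t·G}' = t·{F,G} for all F, G ∈ A. -/
/-- A Jacobi bracket on a commutative ℝ-algebra `A`: an ℝ-bilinear, antisymmetric map
satisfying the Jacobi identity and the generalized Leibniz rule. -/
def IsJacobiBracket (A : Type*) [CommRing A] [Algebra ℝ A] (j : A → A → A) : Prop :=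
  (∀ a b c : A, j (a + b) c = j a c + j b c) ∧
  (∀ (r : ℝ) (a b : A), j (r • a) b = r • j a b) ∧
  (∀ a b c : A, j a (b + c) = j a b + j a c) ∧
  (∀ (r : ℝ) (a b : A), j a (r • b) = r • j a b) ∧
  (∀ a b : A, j a b = - j b a) ∧
  (∀ a b c : A, j (j a b) c = j a (j b c) - j b (j a c)) ∧
  (∀ a b c : A, j a (b * c) = j a b * c + b * j a c - j a 1 * (b * c))

/-- A Poisson bracket on a commutative ℝ-algebra `B`: an ℝ-bilinear, antisymmetric map
satisfying the Jacobi identity, such that each adjoint map is a derivation. -/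
def IsPoissonBracket (B : Type*) [CommRing B] [Algebra ℝ B] (p : B → B → B) : Prop :=
  (∀ a b c : B, p (a + b) c = p a c + p b c) ∧
  (∀ (r : ℝ) (a b : B), p (r • a) b = r • p a b) ∧
  (∀ a b c : B, p a (b + c) = p a b + p a c) ∧
  (∀ (r : ℝ) (a b : B), p a (r • b) = r • p a b) ∧
  (∀ a b : B, p a b = - p b a) ∧
  (∀ a b c : B, p (p a b) c = p a (p b c) - p b (p a c)) ∧
  (∀ a b c : B, p a (b * c) = p a b * c + b * p a c)

/-- The degree-`n` component `A·tⁿ` of the Laurent polynomial algebra `A[t,t⁻¹]`. -/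
def laurentDegComp (A : Type*) [CommRing A] (n : ℤ) : Set (LaurentPolynomial A) :=
  {q | ∃ a : A, q = LaurentPolynomial.C a * LaurentPolynomial.T n}

open LaurentPolynomial

theorem poissonization_exists_biadd {A : Type*} [CommRing A] (f : ℤ → ℤ → A → A → A) (e : ℤ → ℤ → ℤ)
    (h1 : ∀ m n a b c, f m n (a + b) c = f m n a c + f m n b c)
    (h2 : ∀ m n a b c, f m n a (b + c) = f m n a b + f m n a c) :
    ∃ B : LaurentPolynomial A →+ LaurentPolynomial A →+ LaurentPolynomial A,
      ∀ m n a b, B (C a * T m) (C b * T n) = C (f m n a b) * T (e m n) := by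
  let g : ℤ → ℤ → A →+ A →+ LaurentPolynomial A := fun m n =>
    AddMonoidHom.mk' (fun a => AddMonoidHom.mk' (fun b => C (f m n a b) * T (e m n))
      (by intro b c; simp [h2, add_mul]))
      (by intro a b; ext1 c; simp [h1, add_mul])
  let ce : LaurentPolynomial A →+ (ℤ →₀ A) := (AddMonoidAlgebra.coeffAddEquiv).toAddMonoidHom
  have hce : ∀ m a, ce (C a * T m) = Finsupp.single m a := by
    intro m a
    rw [← single_eq_C_mul_T]; rfl
  let G : ℤ → A →+ (LaurentPolynomial A →+ LaurentPolynomial A) := fun m =>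
    AddMonoidHom.mk' (fun a => (Finsupp.liftAddHom (fun n => g m n a)).comp ce)
      (by
        intro a b
        refine AddMonoidHom.ext fun q => ?_
        induction q using LaurentPolynomial.induction_on' with
        | add p q hp hq => rw [map_add, map_add, hp, hq]
        | C_mul_T n c => simp [hce])
  refine ⟨(Finsupp.liftAddHom G).comp ce, ?_⟩
  intro m n a b
  change (Finsupp.liftAddHom G (ce (C a * T m))) (C b * T n) = _
  rw [hce, Finsupp.liftAddHom_apply_single]
  change Finsupp.liftAddHom (fun n => g m n a) (ce (C b * T n)) = _
  rw [hce, Finsupp.liftAddHom_apply_single]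
  rfl

theorem poissonization_derivation_zero {A : Type*} [CommRing A]
    (d : LaurentPolynomial A → LaurentPolynomial A)
    (hadd : ∀ p q, d (p + q) = d p + d q) (hmul : ∀ p q, d (p * q) = d p * q + p * d q)
    (h : ∀ a, d (C a * T 1) = 0) : ∀ p, d p = 0 := by
  have hone : d 1 = 0 := by
    have := hmul 1 1
    simpa using this
  have hT : d (T 1) = 0 := by simpa using h 1
  have inv : ∀ m x, d (T m) = 0 → d (x * T m) = 0 → d x = 0 := by
    intro m x h1 h2
    rw [hmul, h1, mul_zero, add_zero] at h2
    have := congrArg (· * T (-m)) h2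
    simpa only [mul_assoc, ← T_add, add_neg_cancel, T_zero, mul_one, zero_mul] using this
  have hC : ∀ a, d (C a) = 0 := fun a => inv 1 _ hT (h a)
  have hTi : d (T (-1)) = 0 := inv 1 _ hT (by rw [← T_add]; simpa using hone)
  intro p
  induction p using LaurentPolynomial.induction_on with
  | h_C a => exact hC a
  | h_add hp hq => rw [hadd, hp, hq, add_zero]
  | h_C_mul_T n a ih => rw [T_add, ← mul_assoc, hmul, ih, hT]; simp
  | h_C_mul_T_Z n a ih => rw [sub_eq_add_neg, T_add, ← mul_assoc, hmul, ih, hTi]; simp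

/-- The coefficient of the Poissonized bracket on monomials. -/
def poissonizationCoeff {A : Type*} [CommRing A] (j : A → A → A) (m n : ℤ) (a b : A) : A :=
  j a b + (m - 1) • (a * j 1 b) - (n - 1) • (b * j 1 a)

theorem poissonizationCoeff_jacobi {A : Type*} [CommRing A] [Algebra ℝ A] (j : A → A → A)
    (hj : IsJacobiBracket A j) (m n k : ℤ) (a b c : A) :
    poissonizationCoeff j (m + n - 1) k (poissonizationCoeff j m n a b) c
    = poissonizationCoeff j m (n + k - 1) a (poissonizationCoeff j n k b c)
      - poissonizationCoeff j n (m + k - 1) b (poissonizationCoeff j m k a c) := by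
  obtain ⟨ha1, -, ha2, -, hanti, hjac, hl⟩ := hj
  have hz2 : ∀ (z : ℤ) x y, j x (z • y) = z • j x y := fun z x y =>
    map_zsmul (AddMonoidHom.mk' (j x) (ha2 x)) z y
  have hz1 : ∀ (z : ℤ) x y, j (z • x) y = z • j x y := fun z x y =>
    map_zsmul (AddMonoidHom.mk' (fun x => j x y) (fun a b => ha1 a b y)) z x
  have hs2 : ∀ x y z, j x (y - z) = j x y - j x z := fun x y z =>
    map_sub (AddMonoidHom.mk' (j x) (ha2 x)) y z
  have hs1 : ∀ x y z, j (x - y) z = j x z - j y z := fun x y z =>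
    map_sub (AddMonoidHom.mk' (fun x => j x z) (fun a b => ha1 a b z)) x y
  have h11 : j 1 1 = 0 := by
    have h2 : (2 : ℝ) • j 1 1 = 0 := by
      rw [two_smul]; nth_rewrite 1 [hanti 1 1]; exact neg_add_cancel _
    have h3 := congrArg (fun x => (2⁻¹ : ℝ) • x) h2
    simpa [smul_smul] using h3
  have hr : ∀ x y z, j (x * y) z = j x z * y + x * j y z - j 1 z * (x * y) := by
    intro x y z
    rw [hanti, hl, hanti z x, hanti z y, hanti z 1]; ring
  have hD : ∀ x, j x 1 = - j 1 x := fun x => hanti x 1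
  have hJ1 : ∀ x y, j 1 (j x y) = j (j 1 x) y + j x (j 1 y) := by
    intro x y; rw [hjac 1 x y]; ring
  simp only [poissonizationCoeff, ha1, ha2, hs1, hs2, hz1, hz2, hl, hr, hJ1 a b, hJ1 a c, hJ1 b c, h11,
    hjac a b c]
  simp only [hD, zsmul_eq_mul]
  push_cast
  rw [hanti (j 1 a) c, hanti (j 1 b) c, hanti (j 1 a) b, hanti b a]
  ring

/-- **Poissonization of a Jacobi bracket.** Given a Jacobi bracket `{·,·}` on a commutative
ℝ-algebra `A`, there is a unique Poisson bracket `{·,·}'` on the Laurent polynomial algebra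
`A[t,t⁻¹]` that is homogeneous of degree `-1` with respect to the ℤ-grading with `deg t = 1`
and satisfies `{t·F, t·G}' = t·{F,G}` for all `F, G ∈ A`. -/
theorem statement0 {A : Type*} [CommRing A] [Algebra ℝ A] (j : A → A → A)
    (hj : IsJacobiBracket A j) :
    ∃! B : LaurentPolynomial A → LaurentPolynomial A → LaurentPolynomial A,
      IsPoissonBracket (LaurentPolynomial A) B ∧
      (∀ (m n : ℤ) (p q : LaurentPolynomial A),
        p ∈ laurentDegComp A m → q ∈ laurentDegComp A n → B p q ∈ laurentDegComp A (m + n - 1)) ∧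
      (∀ F G : A,
        B (LaurentPolynomial.C F * LaurentPolynomial.T 1)
          (LaurentPolynomial.C G * LaurentPolynomial.T 1)
        = LaurentPolynomial.C (j F G) * LaurentPolynomial.T 1) := by
  have hj' := hj
  obtain ⟨ha1, hs1, ha2, hs2, hanti, hjac, hl⟩ := hj'
  have h11 : j 1 1 = 0 := by
    have h2 : (2 : ℝ) • j 1 1 = 0 := by
      rw [two_smul]; nth_rewrite 1 [hanti 1 1]; exact neg_add_cancel _
    have h3 := congrArg (fun x => (2⁻¹ : ℝ) • x) h2
    simpa [smul_smul] using h3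
  obtain ⟨B, hB⟩ := poissonization_exists_biadd (poissonizationCoeff j) (fun m n => m + n - 1)
    (by intro m n a b c; simp only [poissonizationCoeff, ha1, ha2, add_mul, mul_add, smul_add]; abel)
    (by intro m n a b c; simp only [poissonizationCoeff, ha1, ha2, add_mul, mul_add, smul_add]; abel)
  have hsm : ∀ (r : ℝ) (a : A) (n : ℤ), r • (C a * T n : LaurentPolynomial A) = C (r • a) * T n := by
    intro r a n
    rw [← single_eq_C_mul_T, ← single_eq_C_mul_T, AddMonoidAlgebra.smul_single]
  apply existsUnique_of_exists_of_unique
  · refine ⟨fun p q => B p q, ⟨⟨?_, ?_, ?_, ?_, ?_, ?_, ?_⟩, ?_, ?_⟩⟩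
    · intro a b c; simp
    · intro r p q
      induction p using LaurentPolynomial.induction_on' with
      | add p p' hp hp' => simp only [smul_add, map_add, AddMonoidHom.add_apply] at *; rw [hp, hp']
      | C_mul_T m a =>
        induction q using LaurentPolynomial.induction_on' with
        | add q q' hq hq' => simp only [smul_add, map_add] at *; rw [hq, hq']
        | C_mul_T n b =>
          simp only [hsm, hB]
          congr 2
          simp only [poissonizationCoeff, hs1, hs2, smul_mul_assoc, mul_smul_comm, smul_sub, smul_add,
            smul_comm r (_ : ℤ)]
    · intro a b c; simp
    · intro r p q
      induction p using LaurentPolynomial.induction_on' with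
      | add p p' hp hp' => simp only [smul_add, map_add, AddMonoidHom.add_apply] at *; rw [hp, hp']
      | C_mul_T m a =>
        induction q using LaurentPolynomial.induction_on' with
        | add q q' hq hq' => simp only [smul_add, map_add] at *; rw [hq, hq']
        | C_mul_T n b =>
          simp only [hsm, hB]
          congr 2
          simp only [poissonizationCoeff, hs1, hs2, smul_mul_assoc, mul_smul_comm, smul_sub, smul_add,
            smul_comm r (_ : ℤ)]
    · intro p q
      induction p using LaurentPolynomial.induction_on' with
      | add p p' hp hp' => simp only [map_add, AddMonoidHom.add_apply] at *; rw [hp, hp']; abel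
      | C_mul_T m a =>
        induction q using LaurentPolynomial.induction_on' with
        | add q q' hq hq' => simp only [map_add, AddMonoidHom.add_apply] at *; rw [hq, hq']; abel
        | C_mul_T n b =>
          simp only [hB]
          rw [add_comm n m, ← neg_mul, ← map_neg]
          congr 2
          simp only [poissonizationCoeff]
          rw [hanti a b]; abel
    · intro p q s
      induction p using LaurentPolynomial.induction_on' with
      | add p p' hp hp' => simp only [map_add, AddMonoidHom.add_apply] at *; rw [hp, hp']; abel
      | C_mul_T m a =>
        induction q using LaurentPolynomial.induction_on' with
        | add q q' hq hq' => simp only [map_add, AddMonoidHom.add_apply] at *; rw [hq, hq']; abel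
        | C_mul_T n b =>
          induction s using LaurentPolynomial.induction_on' with
          | add q q' hq hq' => simp only [map_add, AddMonoidHom.add_apply] at *; rw [hq, hq']; abel
          | C_mul_T k c =>
            simp only [hB]
            rw [poissonizationCoeff_jacobi j hj, map_sub, sub_mul]
            congr 3 <;> ring
    · intro p q s
      induction p using LaurentPolynomial.induction_on' with
      | add p p' hp hp' => simp only [map_add, AddMonoidHom.add_apply] at *; rw [hp, hp']; ring
      | C_mul_T m a =>
        induction q using LaurentPolynomial.induction_on' with
        | add q q' hq hq' => simp only [map_add, AddMonoidHom.add_apply, add_mul] at *; rw [hq, hq']; ring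
        | C_mul_T n b =>
          induction s using LaurentPolynomial.induction_on' with
          | add q q' hq hq' => simp only [map_add, AddMonoidHom.add_apply, mul_add] at *; rw [hq, hq']; ring
          | C_mul_T k c =>
            have hm : ∀ (x y : A) (u v : ℤ), (C x * T u * (C y * T v) : LaurentPolynomial A)
                = C (x * y) * T (u + v) := by
              intro x y u v; rw [T_add, map_mul]; ring
            simp only [hB, hm]
            rw [show m + n - 1 + k = m + (n + k) - 1 by ring,
              show n + (m + k - 1) = m + (n + k) - 1 by ring, ← add_mul, ← map_add]
            congr 2
            simp only [poissonizationCoeff, hl, h11, zsmul_eq_mul, hanti a 1]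
            push_cast
            ring
    · rintro m n _ _ ⟨a, rfl⟩ ⟨b, rfl⟩
      exact ⟨_, hB m n a b⟩
    · intro F G
      simp [hB, poissonizationCoeff]
  · rintro B₁ B₂ ⟨⟨ba1, -, ba2, -, banti, -, bl⟩, -, bt⟩ ⟨⟨ca1, -, ca2, -, canti, -, cl⟩, -, ct⟩
    have key : ∀ p, (∀ a, B₁ p (C a * T 1) = B₂ p (C a * T 1)) → ∀ q, B₁ p q = B₂ p q := by
      intro p hp q
      refine sub_eq_zero.mp (poissonization_derivation_zero (fun q => B₁ p q - B₂ p q) ?_ ?_ ?_ q)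
      · intro x y
        simp only [ba2, ca2]; ring
      · intro x y
        simp only [bl, cl]; ring
      · intro a
        simp only [hp a, sub_self]
    funext p q
    refine key p (fun a => ?_) q
    rw [banti, canti, key _ (fun b => ?_) p]
    rw [bt, ct]
end

section
/- Let A be a commutative ℝ-algebra and {·,·}' a Poisson bracket on the Laurent polynomial algebra A[t,t⁻¹] that is homogeneous of degree −1 with respect to the ℤ-grading with deg t = 1. Then the map {·,·} : A × A → A determined by the identity t·{F,G} = {t·F, t·G}' is a Jacobi bracket on A. -/
/-- **From homogeneous Poisson brackets to Jacobi brackets.** If `{·,·}'` is a Poisson bracket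
on the Laurent polynomial algebra `A[t,t⁻¹]` which is homogeneous of degree `-1` with respect
to the ℤ-grading with `deg t = 1`, then the map `{·,·} : A × A → A` determined by the identity
`t·{F,G} = {t·F, t·G}'` is a Jacobi bracket on `A`. -/
theorem statement1 {A : Type*} [CommRing A] [Algebra ℝ A]
    (B : LaurentPolynomial A → LaurentPolynomial A → LaurentPolynomial A)
    (hB : IsPoissonBracket (LaurentPolynomial A) B)
    (hhom : ∀ (m n : ℤ) (p q : LaurentPolynomial A),
      p ∈ laurentDegComp A m → q ∈ laurentDegComp A n → B p q ∈ laurentDegComp A (m + n - 1))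
    (j : A → A → A)
    (hcompat : ∀ F G : A,
      LaurentPolynomial.C (j F G) * LaurentPolynomial.T 1
        = B (LaurentPolynomial.C F * LaurentPolynomial.T 1)
            (LaurentPolynomial.C G * LaurentPolynomial.T 1)) :
    IsJacobiBracket A j := by
  obtain ⟨h1, h2, h3, h4, h5, h6, h7⟩ := hB
  have hinj : ∀ a b : A, (LaurentPolynomial.C a * LaurentPolynomial.T 1 : LaurentPolynomial A)
      = LaurentPolynomial.C b * LaurentPolynomial.T 1 → a = b := by
    intro a b h
    have h' := (LaurentPolynomial.isUnit_T (R := A) 1).mul_right_cancel h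
    rw [← LaurentPolynomial.single_eq_C, ← LaurentPolynomial.single_eq_C] at h'
    exact Finsupp.single_injective 0 (congrArg AddMonoidAlgebra.coeff h')
  have hsmul : ∀ (r : ℝ) (a : A), (LaurentPolynomial.C (r • a) * LaurentPolynomial.T 1 :
      LaurentPolynomial A) = r • (LaurentPolynomial.C a * LaurentPolynomial.T 1) := by
    intro r a
    rw [← LaurentPolynomial.single_eq_C_mul_T, ← LaurentPolynomial.single_eq_C_mul_T,
      AddMonoidAlgebra.smul_single]
  refine ⟨fun a b c => hinj _ _ ?_, fun r a b => hinj _ _ ?_, fun a b c => hinj _ _ ?_,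
    fun r a b => hinj _ _ ?_, fun a b => hinj _ _ ?_, fun a b c => hinj _ _ ?_,
    fun a b c => hinj _ _ ?_⟩
  · simp only [map_add, add_mul, hcompat, h1]
  · simp only [hsmul, hcompat, h2]
  · simp only [map_add, add_mul, hcompat, h3]
  · simp only [hsmul, hcompat, h4]
  · simp only [map_neg, neg_mul, hcompat]
    exact h5 _ _
  · simp only [map_sub, sub_mul, hcompat, h6]
  · apply (LaurentPolynomial.isUnit_T (R := A) 1).mul_right_cancel
    have e1 := h7 (LaurentPolynomial.C a * LaurentPolynomial.T 1)
      (LaurentPolynomial.C b * LaurentPolynomial.T 1)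
      (LaurentPolynomial.C c * LaurentPolynomial.T 1)
    have e2 := h7 (LaurentPolynomial.C a * LaurentPolynomial.T 1)
      (LaurentPolynomial.C (b * c) * LaurentPolynomial.T 1)
      (LaurentPolynomial.C 1 * LaurentPolynomial.T 1)
    have e3 : (LaurentPolynomial.C (b * c) * LaurentPolynomial.T 1 *
        (LaurentPolynomial.C 1 * LaurentPolynomial.T 1) : LaurentPolynomial A) =
        LaurentPolynomial.C b * LaurentPolynomial.T 1 *
        (LaurentPolynomial.C c * LaurentPolynomial.T 1) := by
      simp only [map_mul, map_one]
      ring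
    rw [e3, e1] at e2
    simp only [← hcompat] at e2
    simp only [map_sub, map_add, map_mul, map_one] at e2 ⊢
    linear_combination -e2
end

section
/- Let {·,·} be a Jacobi bracket on a commutative ℝ-algebra A. Then Γ := {1,·} is an ℝ-linear derivation of A, and the map Λ(F,G) := {F,G} − F·Γ(G) + Γ(F)·G is antisymmetric and is an ℝ-linear derivation of A in each of its two arguments (a skew-symmetric biderivation). In particular {F,G} = Λ(F,G) + F·Γ(G) − Γ(F)·G, so every Jacobi bracket is represented by a bidifferential operator of total order two of the form Λ + Γ·I. -/
/-- **Structure of Jacobi brackets.** For a Jacobi bracket `{·,·}` on a commutative ℝ-algebra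
`A`, the map `Γ := {1,·}` is an ℝ-linear derivation of `A`, and
`Λ(F,G) := {F,G} − F·Γ(G) + Γ(F)·G` is an antisymmetric biderivation: it is an ℝ-linear
derivation of `A` in each argument. In particular `{F,G} = Λ(F,G) + F·Γ(G) − Γ(F)·G`, so every
Jacobi bracket is represented by a first-order bidifferential operator of the form `Λ + Γ·I`. -/
theorem statement2 {A : Type*} [CommRing A] [Algebra ℝ A] (j : A → A → A)
    (hj : IsJacobiBracket A j)
    (Γ : A → A) (hΓ : ∀ a : A, Γ a = j 1 a)
    (Λ : A → A → A) (hΛ : ∀ F G : A, Λ F G = j F G - F * Γ G + Γ F * G) :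
    -- Γ is an ℝ-linear derivation of A
    (∀ a b : A, Γ (a + b) = Γ a + Γ b) ∧
    (∀ (r : ℝ) (a : A), Γ (r • a) = r • Γ a) ∧
    (∀ a b : A, Γ (a * b) = Γ a * b + a * Γ b) ∧
    -- Λ is antisymmetric
    (∀ F G : A, Λ F G = - Λ G F) ∧
    -- Λ is an ℝ-linear derivation in the first argument
    (∀ F G H : A, Λ (F + G) H = Λ F H + Λ G H) ∧
    (∀ (r : ℝ) (F G : A), Λ (r • F) G = r • Λ F G) ∧
    (∀ F G H : A, Λ (F * G) H = F * Λ G H + G * Λ F H) ∧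
    -- Λ is an ℝ-linear derivation in the second argument
    (∀ F G H : A, Λ F (G + H) = Λ F G + Λ F H) ∧
    (∀ (r : ℝ) (F G : A), Λ F (r • G) = r • Λ F G) ∧
    (∀ F G H : A, Λ F (G * H) = G * Λ F H + H * Λ F G) ∧
    -- the bracket is represented as Λ + Γ·I
    (∀ F G : A, j F G = Λ F G + F * Γ G - Γ F * G) := by
  obtain ⟨ha1, hs1, ha2, hs2, hanti, -, hL⟩ := hj
  have h11 : j 1 1 = 0 := by
    have h : j 1 1 + j 1 1 = 0 := by
      nth_rewrite 1 [hanti 1 1]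
      exact neg_add_cancel _
    have h2 : (2 : ℝ) • j 1 1 = 0 := by rw [two_smul]; exact h
    have h3 : (2⁻¹ : ℝ) • ((2 : ℝ) • j 1 1) = j 1 1 := by
      rw [smul_smul]; norm_num
    rw [← h3, h2, smul_zero]
  have hΓa : ∀ a b : A, Γ (a + b) = Γ a + Γ b := fun a b => by
    simp only [hΓ, ha2]
  have hΓs : ∀ (r : ℝ) (a : A), Γ (r • a) = r • Γ a := fun r a => by
    simp only [hΓ, hs2]
  have hΓm : ∀ a b : A, Γ (a * b) = Γ a * b + a * Γ b := fun a b => by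
    rw [hΓ, hL, h11, hΓ, hΓ]; ring
  have hj1 : ∀ a : A, j a 1 = - Γ a := fun a => by rw [hΓ, hanti]
  have hΛanti : ∀ F G : A, Λ F G = - Λ G F := fun F G => by
    rw [hΛ, hΛ, hanti F G]; ring
  have hΛa : ∀ F G H : A, Λ F (G + H) = Λ F G + Λ F H := fun F G H => by
    simp only [hΛ, hΓa, ha2]; ring
  have hΛs : ∀ (r : ℝ) (F G : A), Λ F (r • G) = r • Λ F G := fun r F G => by
    simp only [hΛ, hΓs, hs2, mul_smul_comm, smul_add, smul_sub]
  have hΛm : ∀ F G H : A, Λ F (G * H) = G * Λ F H + H * Λ F G := fun F G H => by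
    simp only [hΛ, hΓm, hL F G H, hj1]; ring
  refine ⟨hΓa, hΓs, hΓm, hΛanti, ?_, ?_, ?_, hΛa, hΛs, hΛm, ?_⟩
  · intro F G H
    rw [hΛanti, hΛa, hΛanti F H, hΛanti G H]; ring
  · intro r F G
    rw [hΛanti, hΛs, hΛanti F G, smul_neg]
  · intro F G H
    rw [hΛanti, hΛm, hΛanti F H, hΛanti G H]; ring
  · intro F G
    rw [hΛ]; ring
end

section
/- Let A be a commutative ℝ-algebra, let Λ : A × A → A be an antisymmetric ℝ-bilinear map which is a derivation of A in each argument, and let Γ be an ℝ-linear derivation of A. Assume that for all F, G, H ∈ A: (i) Λ(Λ(F,G),H) + Λ(Λ(G,H),F) + Λ(Λ(H,F),G) = Γ(F)·Λ(G,H) + Γ(G)·Λ(H,F) + Γ(H)·Λ(F,G), and (ii) Γ(Λ(F,G)) = Λ(Γ(F),G) + Λ(F,Γ(G)). Then the bracket {F,G} := Λ(F,G) + F·Γ(G) − Γ(F)·G is a Jacobi bracket on A. -/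
/-- **Construction of Jacobi brackets from a biderivation and a derivation.** Let `Λ` be an
antisymmetric ℝ-bilinear map on a commutative ℝ-algebra `A` that is a derivation in each
argument, and let `Γ` be an ℝ-linear derivation of `A`, satisfying the compatibility
conditions `{Λ,Λ} = 2Γ·Λ` and `{Γ,Λ} = 0` written out on elements. Then
`{F,G} := Λ(F,G) + F·Γ(G) − Γ(F)·G` is a Jacobi bracket on `A`. -/
theorem statement3 {A : Type*} [CommRing A] [Algebra ℝ A]
    (Λ : A → A → A) (Γ : A → A)
    (hΛ_add_left : ∀ F G H : A, Λ (F + G) H = Λ F H + Λ G H)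
    (hΛ_smul_left : ∀ (r : ℝ) (F G : A), Λ (r • F) G = r • Λ F G)
    (hΛ_add_right : ∀ F G H : A, Λ F (G + H) = Λ F G + Λ F H)
    (hΛ_smul_right : ∀ (r : ℝ) (F G : A), Λ F (r • G) = r • Λ F G)
    (hΛ_antisymm : ∀ F G : A, Λ F G = - Λ G F)
    (hΛ_leib_left : ∀ F G H : A, Λ (F * G) H = F * Λ G H + G * Λ F H)
    (hΛ_leib_right : ∀ F G H : A, Λ F (G * H) = G * Λ F H + H * Λ F G)
    (hΓ_add : ∀ a b : A, Γ (a + b) = Γ a + Γ b)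
    (hΓ_smul : ∀ (r : ℝ) (a : A), Γ (r • a) = r • Γ a)
    (hΓ_leib : ∀ a b : A, Γ (a * b) = Γ a * b + a * Γ b)
    (hi : ∀ F G H : A,
      Λ (Λ F G) H + Λ (Λ G H) F + Λ (Λ H F) G
        = Γ F * Λ G H + Γ G * Λ H F + Γ H * Λ F G)
    (hii : ∀ F G : A, Γ (Λ F G) = Λ (Γ F) G + Λ F (Γ G)) :
    IsJacobiBracket A (fun F G => Λ F G + F * Γ G - Γ F * G) := by
  have hΓ_neg : ∀ a : A, Γ (-a) = - Γ a := fun a => by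
    have := hΓ_smul (-1) a
    simpa using this
  have hΛ_nl : ∀ a b : A, Λ (-a) b = - Λ a b := fun a b => by
    have := hΛ_smul_left (-1) a b
    simpa using this
  have hΛ_nr : ∀ a b : A, Λ a (-b) = - Λ a b := fun a b => by
    have := hΛ_smul_right (-1) a b
    simpa using this
  have hΓ1 : Γ 1 = 0 := by
    have := hΓ_leib 1 1
    simpa using this
  have hΛ1 : ∀ a : A, Λ a 1 = 0 := fun a => by
    have := hΛ_leib_right a 1 1
    simpa using this
  refine ⟨?_, ?_, ?_, ?_, ?_, ?_, ?_⟩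
  · intro a b c
    simp only [hΛ_add_left, hΓ_add]; ring
  · intro r a b
    simp only [hΛ_smul_left, hΓ_smul, smul_add, smul_sub, smul_mul_assoc]
  · intro a b c
    simp only [hΛ_add_right, hΓ_add]; ring
  · intro r a b
    simp only [hΛ_smul_right, hΓ_smul, smul_add, smul_sub, mul_smul_comm]
  · intro a b
    simp only []
    rw [hΛ_antisymm a b]; ring
  · intro a b c
    have h := hi a b c
    simp only [sub_eq_add_neg, hΛ_add_left, hΛ_add_right, hΛ_nl, hΛ_nr, hΛ_leib_left,
      hΛ_leib_right, hΓ_add, hΓ_neg, hΓ_leib, hii]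
    rw [hΛ_antisymm c a, hΛ_nl] at h
    rw [hΛ_antisymm a (Λ b c), hΛ_antisymm b (Λ a c), hΛ_antisymm b a,
      hΛ_antisymm b (Γ a), hΛ_antisymm a (Γ b)]
    linear_combination h
  · intro a b c
    simp only [hΛ_leib_right, hΓ_leib, hΓ1, hΛ1]; ring
end

section
/- Let V be a finite-dimensional real vector space, α a linear functional on V, and ω an alternating bilinear form on V. Then the bilinear form Ω_{α,ω} on ℝ × V is nondegenerate if and only if the following three conditions hold: α ≠ 0; the dual space V* is the internal direct sum of the line ℝ·α and the range of ω♭; and the restriction of ω♭ to the kernel of α is injective. -/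
/-- The alternating bilinear form `Ω_{α,ω}` on `ℝ × V` given by
`Ω((s,v),(s',v')) = s·α(v') − s'·α(v) + ω(v,v')`; this is the pointwise model of
the two-form `d(t·α) = dt∧α + t·dα`. -/
def OmegaForm {V : Type*} [AddCommGroup V] [Module ℝ V]
    (α : V →ₗ[ℝ] ℝ) (ω : V → V → ℝ) : ℝ × V → ℝ × V → ℝ :=
  fun u u' => u.1 * α u'.2 - u'.1 * α u.2 + ω u.2 u'.2

/-- Nondegeneracy of a bilinear form `B`: `B(u,·) = 0` implies `u = 0`. -/
def NondegForm {W : Type*} [Zero W] (B : W → W → ℝ) : Prop :=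
  ∀ u : W, (∀ u' : W, B u u' = 0) → u = 0

/-- **Pointwise characterization of contact forms (first version).** For a finite-dimensional
real vector space `V`, a linear functional `α` and an alternating bilinear form `ω` on `V`,
the form `Ω_{α,ω}` on `ℝ × V` is nondegenerate if and only if: `α ≠ 0`; the dual space `V*`
is the internal direct sum of the line `ℝ·α` and the range of `ω♭`; and the restriction of
`ω♭` to the kernel of `α` is injective. -/
theorem statement4 {V : Type*} [AddCommGroup V] [Module ℝ V] [FiniteDimensional ℝ V]
    (α : V →ₗ[ℝ] ℝ) (ω : V →ₗ[ℝ] V →ₗ[ℝ] ℝ) (hω : ∀ v : V, ω v v = 0) :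
    NondegForm (OmegaForm α (fun v w => ω v w)) ↔
      (α ≠ 0 ∧
       (Submodule.span ℝ {α} ⊓ LinearMap.range ω = ⊥ ∧
        Submodule.span ℝ {α} ⊔ LinearMap.range ω = ⊤) ∧
       Set.InjOn (fun v => ω v) (LinearMap.ker α : Set V)) := by
  have key : NondegForm (OmegaForm α (fun v w => ω v w)) ↔
      ∀ (s : ℝ) (v : V), s • α + ω v = 0 → α v = 0 → s = 0 ∧ v = 0 := by
    constructor
    · intro h s v h1 h2
      have := h (s, v) (fun u' => by
        have := LinearMap.congr_fun h1 u'.2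
        simp at this
        simp [OmegaForm, h2, this])
      simpa using this
    · rintro h ⟨s, v⟩ h1
      have h2 : α v = 0 := by simpa [OmegaForm] using h1 (1, 0)
      have h3 : s • α + ω v = 0 := by
        ext w
        simpa [OmegaForm] using h1 (0, w)
      obtain ⟨h4, h5⟩ := h s v h3 h2
      simp [h4, h5]
  rw [key]
  constructor
  · intro h
    have hα : α ≠ 0 := by
      intro h0
      have := (h 1 0 (by simp [h0]) (by simp)).1
      norm_num at this
    refine ⟨hα, ⟨?_, ?_⟩, ?_⟩
    · rw [eq_bot_iff]
      rintro x ⟨hx, ⟨v, hv⟩⟩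
      obtain ⟨c, rfl⟩ := Submodule.mem_span_singleton.1 hx
      by_cases hc : c = 0
      · simp [hc]
      · have h1 : α v = 0 := by
          have := LinearMap.congr_fun hv v
          rw [hω] at this
          simpa [hc] using this.symm
        have := (h (-c) v (by rw [hv]; ext w; simp) h1).1
        exact absurd (neg_eq_zero.1 this) hc
    · let Φ : (ℝ × V) →ₗ[ℝ] (Module.Dual ℝ V × ℝ) :=
        (LinearMap.coprod (LinearMap.toSpanSingleton ℝ (Module.Dual ℝ V) α) ω).prod
          (α.comp (LinearMap.snd ℝ ℝ V))
      have hinj : Function.Injective Φ := by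
        rw [← LinearMap.ker_eq_bot, LinearMap.ker_eq_bot']
        rintro ⟨s, v⟩ hsv
        have h1 := congrArg Prod.fst hsv
        have h2 := congrArg Prod.snd hsv
        obtain ⟨h4, h5⟩ := h s v (by simpa [Φ] using h1) (by simpa [Φ] using h2)
        simp [h4, h5]
      have hsurj : Function.Surjective Φ := by
        refine (LinearMap.injective_iff_surjective_of_finrank_eq_finrank ?_).1 hinj
        rw [Module.finrank_prod, Module.finrank_prod, Subspace.dual_finrank_eq, add_comm]
      rw [eq_top_iff]
      intro β _
      obtain ⟨⟨s, v⟩, hsv⟩ := hsurj (β, 0)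
      have h1 : s • α + ω v = β := congrArg Prod.fst hsv
      rw [← h1]
      exact Submodule.add_mem_sup
        (Submodule.smul_mem _ _ (Submodule.mem_span_singleton_self α)) ⟨v, rfl⟩
    · intro v hv w hw hvw
      have hv' : α v = 0 := hv
      have hw' : α w = 0 := hw
      have hvw' : ω v = ω w := hvw
      exact sub_eq_zero.1 (h 0 (v - w) (by simp [hvw']) (by simp [hv', hw'])).2
  · rintro ⟨hα, ⟨hbot, -⟩, hinj⟩ s v h1 h2
    have hmem : s • α ∈ Submodule.span ℝ {α} ⊓ LinearMap.range ω := by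
      refine ⟨Submodule.smul_mem _ _ (Submodule.mem_span_singleton_self α), -v, ?_⟩
      rw [map_neg]
      exact (eq_neg_of_add_eq_zero_left h1).symm
    rw [hbot, Submodule.mem_bot] at hmem
    have hs : s = 0 := (smul_eq_zero.1 hmem).resolve_right hα
    refine ⟨hs, hinj (show α v = 0 from h2) (show α 0 = 0 from map_zero α) ?_⟩
    simpa [hs] using h1
end

section
/- Let V be a finite-dimensional real vector space, α a linear functional on V, and ω an alternating bilinear form on V. Then the bilinear form Ω_{α,ω} on ℝ × V is nondegenerate if and only if the following three conditions hold: α ≠ 0; the dual space V* is the internal direct sum of the line ℝ·α and the range of ω♭; and the map #_α : V → V* defined by #_α(v) = α(v)·α + ω(v,·) is bijective. -/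
/-- **Pointwise characterization of contact forms (second version).** For a finite-dimensional
real vector space `V`, a linear functional `α` and an alternating bilinear form `ω` on `V`,
the form `Ω_{α,ω}` on `ℝ × V` is nondegenerate if and only if: `α ≠ 0`; the dual space `V*`
is the internal direct sum of the line `ℝ·α` and the range of `ω♭`; and the map
`#_α : V → V*`, `#_α(v) = α(v)·α + ω(v,·)`, is bijective. -/
theorem statement5 {V : Type*} [AddCommGroup V] [Module ℝ V] [FiniteDimensional ℝ V]
    (α : V →ₗ[ℝ] ℝ) (ω : V →ₗ[ℝ] V →ₗ[ℝ] ℝ) (hω : ∀ v : V, ω v v = 0) :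
    NondegForm (OmegaForm α (fun v w => ω v w)) ↔
      (α ≠ 0 ∧
       (Submodule.span ℝ {α} ⊓ LinearMap.range ω = ⊥ ∧
        Submodule.span ℝ {α} ⊔ LinearMap.range ω = ⊤) ∧
       Function.Bijective (fun v : V => α v • α + ω v)) := by
  have hneg : ∀ v w : V, ω v w = - ω w v := by
    intro v w
    have h := hω (v + w)
    simp only [map_add, LinearMap.add_apply, hω] at h
    linarith
  constructor
  · intro h
    have key : ∀ (s : ℝ) (v : V), α v = 0 → s • α + ω v = 0 → s = 0 ∧ v = 0 := by
      intro s v h1 h2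
      have h3 := h (s, v) (by
        rintro ⟨s', v'⟩
        have h4 := LinearMap.congr_fun h2 v'
        simp only [LinearMap.add_apply, LinearMap.smul_apply, smul_eq_mul,
          LinearMap.zero_apply] at h4
        simp only [OmegaForm, h1]
        linarith)
      exact Prod.mk.inj h3
    have hα : α ≠ 0 := by
      intro h0
      have := (key 1 0 (by simp) (by simp [h0])).1
      norm_num at this
    let L : V →ₗ[ℝ] (V →ₗ[ℝ] ℝ) := α.smulRight α + ω
    have hL : ∀ v, L v = α v • α + ω v := fun v => rfl
    have hinj : Function.Injective L := by
      rw [injective_iff_map_eq_zero]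
      intro v hv
      rw [hL] at hv
      have h1 := LinearMap.congr_fun hv v
      simp only [LinearMap.add_apply, LinearMap.smul_apply, smul_eq_mul,
          LinearMap.zero_apply, hω, add_zero, mul_self_eq_zero] at h1
      exact (key (α v) v h1 hv).2
    have hsurj : Function.Surjective L :=
      (LinearMap.injective_iff_surjective_of_finrank_eq_finrank
        (Subspace.dual_finrank_eq (K := ℝ) (V := V)).symm).1 hinj
    refine ⟨hα, ⟨?_, ?_⟩, hinj, hsurj⟩
    · obtain ⟨R, hR⟩ := hsurj α
      rw [hL] at hR
      have h1 := LinearMap.congr_fun hR R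
      simp only [LinearMap.add_apply, LinearMap.smul_apply, smul_eq_mul, hω, add_zero] at h1
      have hR0 : α R ≠ 0 := by
        intro h0
        rw [h0, zero_smul, zero_add] at hR
        have := (key (-1) R h0 (by rw [hR]; ext w; simp only [LinearMap.add_apply, LinearMap.smul_apply, smul_eq_mul, LinearMap.zero_apply]; ring)).1
        norm_num at this
      have hR1 : α R = 1 := mul_right_cancel₀ hR0 (by rw [h1, one_mul])
      have hωR : ω R = 0 := by
        rw [hR1, one_smul] at hR
        simpa using hR
      rw [eq_bot_iff]
      rintro f ⟨hf1, ⟨v, hv⟩⟩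
      obtain ⟨c, rfl⟩ := Submodule.mem_span_singleton.1 hf1
      have h2 := LinearMap.congr_fun hv R
      rw [hneg, hωR] at h2
      simp only [LinearMap.zero_apply, neg_zero, LinearMap.smul_apply, smul_eq_mul, hR1,
        mul_one] at h2
      simp [← h2]
    · rw [eq_top_iff]
      intro f _
      obtain ⟨v, hv⟩ := hsurj f
      rw [← hv, hL]
      exact Submodule.add_mem_sup
        (Submodule.smul_mem _ _ (Submodule.mem_span_singleton_self α)) ⟨v, rfl⟩
  · rintro ⟨hα, ⟨hinf, -⟩, hinj, -⟩ ⟨s, v⟩ h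
    have h1 : α v = 0 := by
      have := h (1, 0)
      simpa [OmegaForm] using this
    have h2 : s • α + ω v = 0 := by
      ext w
      have := h (0, w)
      simpa [OmegaForm] using this
    have h3 : s • α ∈ Submodule.span ℝ {α} ⊓ LinearMap.range ω := by
      refine ⟨Submodule.smul_mem _ _ (Submodule.mem_span_singleton_self α), -v, ?_⟩
      rw [map_neg]
      exact (eq_neg_of_add_eq_zero_left h2).symm
    rw [hinf, Submodule.mem_bot] at h3
    have hs : s = 0 := (smul_eq_zero.1 h3).resolve_right hα
    rw [h3, zero_add] at h2
    have hv : v = 0 := hinj (show α v • α + ω v = α 0 • α + ω 0 by simp [h1, h2])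
    rw [hs, hv]
    rfl
end

section
/- Let V be a real vector space, α a linear functional on V, and ω an alternating bilinear form on V. For every real number c ≠ 0 and every linear functional γ on V, the bilinear form Ω_{α,ω} on ℝ × V is nondegenerate if and only if the bilinear form Ω_{c·α, c·ω + γ∧α} is nondegenerate, where (γ∧α)(v,v') := γ(v)·α(v') − γ(v')·α(v). -/
/-- **Pointwise form of the conformal invariance of the contact condition.** For a real
vector space `V`, a linear functional `α`, an alternating bilinear form `ω` on `V`, a real
number `c ≠ 0` and a linear functional `γ` on `V`, the form `Ω_{α,ω}` on `ℝ × V` is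
nondegenerate if and only if the form `Ω_{c·α, c·ω + γ∧α}` is nondegenerate, where
`(γ∧α)(v,v') := γ(v)·α(v') − γ(v')·α(v)`. -/
theorem statement6 {V : Type*} [AddCommGroup V] [Module ℝ V]
    (α : V →ₗ[ℝ] ℝ) (ω : V →ₗ[ℝ] V →ₗ[ℝ] ℝ) (hω : ∀ v : V, ω v v = 0)
    (c : ℝ) (hc : c ≠ 0) (γ : V →ₗ[ℝ] ℝ) :
    NondegForm (OmegaForm α (fun v w => ω v w)) ↔
      NondegForm (OmegaForm (c • α)
        (fun v w => c * ω v w + (γ v * α w - γ w * α v))) := by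
  have key : ∀ u u' : ℝ × V,
      OmegaForm (c • α) (fun v w => c * ω v w + (γ v * α w - γ w * α v)) u u' =
        c * OmegaForm α (fun v w => ω v w) (u.1 + γ u.2 / c, u.2) (u'.1 + γ u'.2 / c, u'.2) := by
    intro u u'
    simp only [OmegaForm, LinearMap.smul_apply, smul_eq_mul]
    field_simp
    ring
  constructor
  · intro h u hu
    have h0 := h (u.1 + γ u.2 / c, u.2) (by
      intro w
      have h1 := hu (w.1 - γ w.2 / c, w.2)
      rw [key] at h1
      simpa [hc] using h1)
    have h2 : u.2 = 0 := congrArg Prod.snd h0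
    have h1 : u.1 + γ u.2 / c = 0 := congrArg Prod.fst h0
    rw [h2] at h1
    exact Prod.ext (by simpa using h1) h2
  · intro h u hu
    have h0 := h (u.1 - γ u.2 / c, u.2) (by
      intro w
      rw [key]
      have h1 := hu (w.1 + γ w.2 / c, w.2)
      simp [h1])
    have h2 : u.2 = 0 := congrArg Prod.snd h0
    have h1 : u.1 - γ u.2 / c = 0 := congrArg Prod.fst h0
    rw [h2] at h1
    exact Prod.ext (by simpa using h1) h2
end

section
/- Let L be a Lie ring and D : L → L an additive map that is a derivation of the Lie bracket (D[a,b] = [D a, b] + [a, D b] for all a, b ∈ L) and satisfies D ∘ D = 0. Then the derived bracket [a,b]_D := [D a, b] satisfies the Loday (left Leibniz/Jacobi) identity: [a, [b,c]_D]_D = [[a,b]_D, c]_D + [b, [a,c]_D]_D for all a, b, c ∈ L. -/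
/-- **Derived brackets are Loday brackets.** Let `L` be a Lie ring and `D : L → L` an additive
map that is a derivation of the Lie bracket and squares to zero. Then the derived bracket
`[a,b]_D := [D a, b]` satisfies the Loday (left Leibniz/Jacobi) identity
`[a,[b,c]_D]_D = [[a,b]_D,c]_D + [b,[a,c]_D]_D`. -/
theorem statement8 {L : Type*} [LieRing L] (D : L → L)
    (hD_add : ∀ a b : L, D (a + b) = D a + D b)
    (hD_der : ∀ a b : L, D ⁅a, b⁆ = ⁅D a, b⁆ + ⁅a, D b⁆)
    (hD_sq : ∀ a : L, D (D a) = 0) :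
    ∀ a b c : L, ⁅D a, ⁅D b, c⁆⁆ = ⁅D ⁅D a, b⁆, c⁆ + ⁅D b, ⁅D a, c⁆⁆ := by
  intro a b c
  rw [hD_der, hD_sq, zero_lie, zero_add]
  exact leibniz_lie _ _ _
end
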